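/- arXiv:2011.07503 — 8 statements merged into one kernel-verified Lean document; each statement's English description precedes it below -/
import Mathlib

section
/- Let μ be a positive integer. Suppose for each ν > 0, λ(ν) > 0 satisfies the mean constraint Σ_{y=0}^∞ (y − μ) λ(ν)^y/(y!)^ν = 0. Then the CMP probability at μ converges to one as ν → ∞: P_ν(Y = μ) = (λ(ν)^μ/(μ!)^ν)/Z(λ(ν),ν) → 1, and consequently P_ν(Y = y) → 0 for every nonnegative integer y ≠ μ. -/
open Filter Real Topology

/-- Normalizing function of the Conway–Maxwell–Poisson distribution:
`Z(λ, ν) = ∑_{y=0}^∞ λ^y / (y!)^ν`. -/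
noncomputable def cmpZ (l ν : ℝ) : ℝ := ∑' y : ℕ, l ^ y / (y.factorial : ℝ) ^ ν

/-- pmf of the CMP distribution: `P(Y = y) = λ^y / ((y!)^ν Z(λ, ν))`. -/
noncomputable def cmpPmf (l ν : ℝ) (y : ℕ) : ℝ :=
  l ^ y / (y.factorial : ℝ) ^ ν / cmpZ l ν

/-- The mean constraint `∑_{y=0}^∞ (y − μ) λ^y / (y!)^ν = 0`. -/
def meanConstraint (μ l ν : ℝ) : Prop :=
  ∑' y : ℕ, ((y : ℝ) - μ) * l ^ y / (y.factorial : ℝ) ^ ν = 0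

/-- Unnormalized CMP weight `λ^y / (y!)^ν`. -/
noncomputable def cmpWeight (l ν : ℝ) (y : ℕ) : ℝ := l ^ y / (y.factorial : ℝ) ^ ν

theorem cmpWeight_pos {l : ℝ} (hl : 0 < l) (ν : ℝ) (y : ℕ) : 0 < cmpWeight l ν y := by
  have : (0 : ℝ) < y.factorial := by exact_mod_cast y.factorial_pos
  unfold cmpWeight
  positivity

theorem cmpWeight_succ (l ν : ℝ) (y : ℕ) :
    cmpWeight l ν (y + 1) = cmpWeight l ν y * (l / ((y : ℝ) + 1) ^ ν) := by
  unfold cmpWeight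
  rw [Nat.factorial_succ, Nat.cast_mul, Real.mul_rpow (by positivity) (by positivity), pow_succ,
    mul_comm (((y + 1 : ℕ) : ℝ) ^ ν), mul_div_mul_comm]
  push_cast
  rfl

theorem summable_cmpWeight {l ν : ℝ} (hl : 0 < l) (hν : 0 < ν) : Summable (cmpWeight l ν) := by
  refine summable_of_ratio_test_tendsto_lt_one (l := 0) one_pos
    (Eventually.of_forall fun y => (cmpWeight_pos hl ν y).ne') ?_
  have h : Tendsto (fun y : ℕ => l / ((y : ℝ) + 1) ^ ν) atTop (𝓝 0) :=
    ((tendsto_rpow_atTop hν).comp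
      (tendsto_atTop_add_const_right _ 1 tendsto_natCast_atTop_atTop)).const_div_atTop l
  refine h.congr fun y => ?_
  have hy := cmpWeight_pos hl ν y
  rw [← norm_div, cmpWeight_succ, mul_div_cancel_left₀ _ hy.ne', Real.norm_of_nonneg]
  positivity

theorem summable_natCast_mul_cmpWeight {l ν : ℝ} (hl : 0 < l) (hν : 0 < ν) :
    Summable fun y : ℕ => (y : ℝ) * cmpWeight l ν y := by
  refine Summable.of_nonneg_of_le
    (fun y => mul_nonneg y.cast_nonneg (cmpWeight_pos hl ν y).le) (fun y => ?_)
    (summable_cmpWeight (l := 2 * l) (by positivity) hν)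
  have h2 : (y : ℝ) ≤ 2 ^ y := by exact_mod_cast Nat.lt_two_pow_self.le
  have : cmpWeight (2 * l) ν y = 2 ^ y * cmpWeight l ν y := by
    unfold cmpWeight
    rw [mul_pow, mul_div_assoc]
  rw [this]
  exact mul_le_mul_of_nonneg_right h2 (cmpWeight_pos hl ν y).le

theorem cmpWeight_add_le {l ν ε : ℝ} (hl : 0 < l) (hν : 0 < ν) {m : ℕ}
    (h : l / ((m : ℝ) + 1) ^ ν ≤ ε) (j : ℕ) :
    cmpWeight l ν (m + j) ≤ ε ^ j * cmpWeight l ν m := by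
  have hε : 0 ≤ ε := le_trans (by positivity) h
  induction j with
  | zero => simp
  | succ j ih =>
    rw [← add_assoc, cmpWeight_succ, pow_succ, mul_right_comm]
    refine mul_le_mul ih (le_trans ?_ h) (by positivity)
      (mul_nonneg (by positivity) (cmpWeight_pos hl ν m).le)
    gcongr
    simp

theorem cmpWeight_sub_le {l ν ε : ℝ} (hl : 0 < l) (hν : 0 < ν) {m : ℕ}
    (h : (m : ℝ) ^ ν / l ≤ ε) {j : ℕ} (hj : j ≤ m) :
    cmpWeight l ν (m - j) ≤ ε ^ j * cmpWeight l ν m := by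
  have hε : 0 ≤ ε := le_trans (by positivity) h
  induction j with
  | zero => simp
  | succ j ih =>
    obtain ⟨k, rfl⟩ := Nat.exists_eq_add_of_le hj
    have ih := ih (by omega)
    rw [show j + 1 + k - j = k + 1 by omega, cmpWeight_succ] at ih
    rw [show j + 1 + k - (j + 1) = k by omega, pow_succ, mul_right_comm]
    have hk : ((k : ℝ) + 1) ^ ν / l ≤ ε := by
      refine le_trans ?_ h
      gcongr
      push_cast
      linarith [(j.cast_nonneg : (0 : ℝ) ≤ j)]
    have hk0 : (0 : ℝ) < ((k : ℝ) + 1) ^ ν := by positivity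
    calc cmpWeight l ν k
        = cmpWeight l ν k * (l / ((k : ℝ) + 1) ^ ν) * (((k : ℝ) + 1) ^ ν / l) := by
          field_simp
      _ ≤ _ := mul_le_mul ih hk (by positivity)
          (mul_nonneg (by positivity) (cmpWeight_pos hl ν _).le)

/-- The weight above `m` is controlled when the ratio of successive weights there is small. -/
theorem tsum_sub_mul_cmpWeight_le {l ν ε : ℝ} (hl : 0 < l) (hν : 0 < ν) (hε1 : ε < 1) {m : ℕ}
    (h : l / ((m : ℝ) + 1) ^ ν ≤ ε)
    (hs : Summable fun y : ℕ => ((y - m : ℕ) : ℝ) * cmpWeight l ν y) :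
    ∑' y : ℕ, ((y - m : ℕ) : ℝ) * cmpWeight l ν y ≤ ε / (1 - ε) ^ 2 * cmpWeight l ν m := by
  have hε : 0 ≤ ε := le_trans (by positivity) h
  have hg := (hasSum_coe_mul_geometric_of_norm_lt_one
    (show ‖ε‖ < 1 by rwa [Real.norm_of_nonneg hε])).mul_right (cmpWeight l ν m)
  rw [← hs.sum_add_tsum_nat_add m, Finset.sum_eq_zero, zero_add, ← hg.tsum_eq]
  · refine Summable.tsum_le_tsum (fun j => ?_) ((summable_nat_add_iff m).2 hs) hg.summable
    rw [Nat.add_sub_cancel, mul_assoc, add_comm]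
    exact mul_le_mul_of_nonneg_left (cmpWeight_add_le hl hν h j) j.cast_nonneg
  · intro y hy
    rw [Nat.sub_eq_zero_of_le (Finset.mem_range.1 hy).le]
    simp

/-- The weight below `m` is controlled when the reverse ratio of successive weights is small. -/
theorem tsum_rev_sub_mul_cmpWeight_le {l ν ε : ℝ} (hl : 0 < l) (hν : 0 < ν) (hε1 : ε < 1) {m : ℕ}
    (h : (m : ℝ) ^ ν / l ≤ ε) :
    ∑' y : ℕ, ((m - y : ℕ) : ℝ) * cmpWeight l ν y ≤ ε / (1 - ε) ^ 2 * cmpWeight l ν m := by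
  have hε : 0 ≤ ε := le_trans (by positivity) h
  have hg := (hasSum_coe_mul_geometric_of_norm_lt_one
    (show ‖ε‖ < 1 by rwa [Real.norm_of_nonneg hε])).mul_right (cmpWeight l ν m)
  rw [tsum_eq_sum (s := Finset.range (m + 1)), ← Finset.sum_range_reflect, ← hg.tsum_eq]
  · refine le_trans (Finset.sum_le_sum fun j hj => ?_)
      (hg.summable.sum_le_tsum (Finset.range (m + 1)) fun j _ =>
        mul_nonneg (by positivity) (cmpWeight_pos hl ν m).le)
    have hj' : j ≤ m := Nat.lt_succ_iff.1 (Finset.mem_range.1 hj)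
    rw [show m + 1 - 1 - j = m - j by omega, Nat.sub_sub_self hj', mul_assoc]
    exact mul_le_mul_of_nonneg_left (cmpWeight_sub_le hl hν h hj') j.cast_nonneg
  · intro y hy
    rw [Nat.sub_eq_zero_of_le (by simp at hy; omega)]
    simp

/-- Under the mean constraint, the total weight away from the mean is at most a small multiple
of the weight at the mean. -/
theorem cmpZ_sub_cmpWeight_le {l ν : ℝ} (hl : 0 < l) (hν : 0 < ν) {m : ℕ}
    (hmean : meanConstraint m l ν) {ε : ℝ} (hε : ε = ((m : ℝ) / (m + 1)) ^ (ν / 2))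
    (hε0 : 0 < ε) (hε1 : ε < 1) :
    cmpZ l ν - cmpWeight l ν m ≤ 2 * (ε / (1 - ε) ^ 2) * cmpWeight l ν m := by
  have hw : ∀ y, 0 ≤ cmpWeight l ν y := fun y => (cmpWeight_pos hl ν y).le
  have hs := summable_cmpWeight hl hν
  have hsn := summable_natCast_mul_cmpWeight hl hν
  have hup : Summable fun y : ℕ => ((y - m : ℕ) : ℝ) * cmpWeight l ν y := by
    refine hsn.of_nonneg_of_le (fun y => mul_nonneg (Nat.cast_nonneg _) (hw y)) fun y =>
      mul_le_mul_of_nonneg_right (by exact_mod_cast Nat.sub_le y m) (hw y)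
  have hlow : Summable fun y : ℕ => ((m - y : ℕ) : ℝ) * cmpWeight l ν y := by
    refine (hs.mul_left (m : ℝ)).of_nonneg_of_le
      (fun y => mul_nonneg (Nat.cast_nonneg _) (hw y)) fun y =>
      mul_le_mul_of_nonneg_right (by exact_mod_cast Nat.sub_le m y) (hw y)
  have hbal : ∑' y : ℕ, ((y - m : ℕ) : ℝ) * cmpWeight l ν y
      = ∑' y : ℕ, ((m - y : ℕ) : ℝ) * cmpWeight l ν y := by
    rw [← sub_eq_zero, ← hup.tsum_sub hlow, ← hmean]
    refine tsum_congr fun y => ?_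
    rw [← sub_mul, mul_div_assoc, ← cmpWeight]
    congr 1
    rcases le_total m y with h | h <;> simp [Nat.cast_sub h, Nat.sub_eq_zero_of_le h]
  have hZ : cmpZ l ν - cmpWeight l ν m ≤ ∑' y : ℕ, ((y - m : ℕ) : ℝ) * cmpWeight l ν y
      + ∑' y : ℕ, ((m - y : ℕ) : ℝ) * cmpWeight l ν y := by
    have h1 : cmpZ l ν = cmpWeight l ν m + ∑' y, if y = m then 0 else cmpWeight l ν y :=
      hs.tsum_eq_add_tsum_ite m
    have h2 : Summable fun y => if y = m then 0 else cmpWeight l ν y :=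
      hs.of_nonneg_of_le (fun y => by split_ifs; exacts [le_rfl, hw y])
        (fun y => by split_ifs; exacts [hw y, le_rfl])
    rw [h1, add_sub_cancel_left, ← hup.tsum_add hlow]
    refine h2.tsum_le_tsum (fun y => ?_) (hup.add hlow)
    rw [← add_mul]
    split_ifs with h
    · exact mul_nonneg (by positivity) (hw y)
    · refine le_mul_of_one_le_left (hw y) ?_
      exact_mod_cast (by omega : 1 ≤ (y - m) + (m - y))
  rcases le_or_gt (l / ((m : ℝ) + 1) ^ ν) ε with h | h
  · have := tsum_sub_mul_cmpWeight_le hl hν hε1 h hup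
    linarith
  · have hq : ε * ε * ((m : ℝ) + 1) ^ ν = (m : ℝ) ^ ν := by
      rw [hε, ← Real.mul_rpow (by positivity) (by positivity), ← sq, ← Real.rpow_natCast_mul
        (by positivity), Nat.cast_ofNat, mul_div_cancel₀ ν two_ne_zero,
        ← Real.mul_rpow (by positivity) (by positivity), div_mul_cancel₀ _ (by positivity)]
    have h' : (m : ℝ) ^ ν / l ≤ ε := by
      rw [lt_div_iff₀ (by positivity)] at h
      rw [div_le_iff₀ hl, ← hq, mul_assoc]
      exact mul_le_mul_of_nonneg_left h.le hε0.le
    have := tsum_rev_sub_mul_cmpWeight_le hl hν hε1 h'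
    linarith

theorem cmpWeight_add_le_cmpZ {l ν : ℝ} (hl : 0 < l) (hν : 0 < ν) {m y : ℕ} (hy : y ≠ m) :
    cmpWeight l ν y + cmpWeight l ν m ≤ cmpZ l ν := by
  rw [← Finset.sum_pair hy]
  exact (summable_cmpWeight hl hν).sum_le_tsum _ fun k _ => (cmpWeight_pos hl ν k).le

/-- For a positive integer mean `μ`, the mean-parametrized CMP probability at `μ`
tends to 1 as `ν → ∞`, and the probability at every other value tends to 0. -/
theorem stmt0 (μ : ℕ) (hμ : 1 ≤ μ) (lam : ℝ → ℝ)
    (hlam : ∀ ν : ℝ, 0 < ν → 0 < lam ν ∧ meanConstraint (μ : ℝ) (lam ν) ν) :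
    Tendsto (fun ν : ℝ => cmpPmf (lam ν) ν μ) atTop (𝓝 1) ∧
    ∀ y : ℕ, y ≠ μ → Tendsto (fun ν : ℝ => cmpPmf (lam ν) ν y) atTop (𝓝 0) := by
  set B : ℝ → ℝ := fun ν =>
    2 * (((μ : ℝ) / (μ + 1)) ^ (ν / 2) / (1 - ((μ : ℝ) / (μ + 1)) ^ (ν / 2)) ^ 2) with hB
  have hμ0 : (0 : ℝ) < μ := by exact_mod_cast hμ
  have hb0 : (0 : ℝ) < (μ : ℝ) / (μ + 1) := by positivity
  have hb1 : (μ : ℝ) / (μ + 1) < 1 := by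
    rw [div_lt_one (by positivity)]
    linarith
  have hBlim : Tendsto B atTop (𝓝 0) := by
    have hε : Tendsto (fun ν : ℝ => ((μ : ℝ) / (μ + 1)) ^ (ν / 2)) atTop (𝓝 0) :=
      (tendsto_rpow_atTop_of_base_lt_one _ (by linarith) hb1).comp
        (tendsto_id.atTop_div_const two_pos)
    have := (hε.div ((tendsto_const_nhds (x := (1 : ℝ))).sub hε |>.pow 2) (by norm_num)).const_mul 2
    simpa using this
  have key : ∀ ν : ℝ, 0 < ν → cmpPmf (lam ν) ν μ ≤ 1 ∧ 1 - B ν ≤ cmpPmf (lam ν) ν μ ∧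
      ∀ y, y ≠ μ → 0 ≤ cmpPmf (lam ν) ν y ∧ cmpPmf (lam ν) ν y ≤ B ν := by
    intro ν hν
    obtain ⟨hl, hmean⟩ := hlam ν hν
    have hZ := cmpZ_sub_cmpWeight_le hl hν hmean rfl (Real.rpow_pos_of_pos hb0 _)
      (Real.rpow_lt_one hb0.le hb1 (by positivity))
    change _ ≤ B ν * _ at hZ
    have hB0 : 0 ≤ B ν := by
      simp only [hB]
      positivity
    have hm := cmpWeight_pos hl ν μ
    have hle : cmpWeight (lam ν) ν μ ≤ cmpZ (lam ν) ν := by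
      linarith [cmpWeight_add_le_cmpZ hl hν (Nat.succ_ne_self μ), cmpWeight_pos hl ν (μ + 1)]
    have hZ0 : 0 < cmpZ (lam ν) ν := hm.trans_le hle
    have hBZ : B ν * cmpWeight (lam ν) ν μ ≤ B ν * cmpZ (lam ν) ν :=
      mul_le_mul_of_nonneg_left hle hB0
    refine ⟨(div_le_one hZ0).2 hle, (le_div_iff₀ hZ0).2 ?_, fun y hy =>
      ⟨div_nonneg (cmpWeight_pos hl ν y).le hZ0.le, (div_le_iff₀ hZ0).2 ?_⟩⟩
    · change _ ≤ cmpWeight (lam ν) ν μ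
      linarith
    · change cmpWeight (lam ν) ν y ≤ _
      linarith [cmpWeight_add_le_cmpZ hl hν hy]
  have hpos : ∀ᶠ ν : ℝ in atTop, 0 < ν := eventually_gt_atTop 0
  constructor
  · refine tendsto_of_tendsto_of_tendsto_of_le_of_le' (g := fun ν => 1 - B ν)
      (by simpa using hBlim.const_sub 1) tendsto_const_nhds ?_ ?_
    · filter_upwards [hpos] with ν hν using (key ν hν).2.1
    · filter_upwards [hpos] with ν hν using (key ν hν).1
  · intro y hy
    refine tendsto_of_tendsto_of_tendsto_of_le_of_le' tendsto_const_nhds hBlim ?_ ?_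
    · filter_upwards [hpos] with ν hν using ((key ν hν).2.2 y hy).1
    · filter_upwards [hpos] with ν hν using ((key ν hν).2.2 y hy).2
end

section
/- Let μ > 0 be a non-integer real number and set Δ = μ − ⌊μ⌋ ∈ (0,1). Suppose for each ν > 0, λ(ν) > 0 satisfies the mean constraint Σ_{y=0}^∞ (y − μ) λ(ν)^y/(y!)^ν = 0. Then as ν → ∞ the CMP distribution converges to the shifted Bernoulli on the two integers ⌊μ⌋ and ⌈μ⌉ with probabilities equal to the fractional parts of μ: P_ν(Y = ⌊μ⌋) → 1 − Δ and P_ν(Y = ⌈μ⌉) → Δ, and P_ν(Y = y) → 0 for every other nonnegative integer y. -/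
open Filter Real Topology

lemma HasSum.congr_forall {f g : ℕ → ℝ} {a : ℝ} (h : HasSum f a) (hfg : ∀ y, f y = g y) :
    HasSum g a :=
  (funext hfg : f = g) ▸ h

/-- Terms of the CMP normalizing series, together with their first-moment counterparts, are
summable once `1 ≤ ν`. -/
lemma summable_cmp_terms {l ν : ℝ} (hl : 0 < l) (hν : 1 ≤ ν) :
    Summable (fun y : ℕ => l ^ y / (y.factorial : ℝ) ^ ν) ∧
    Summable (fun y : ℕ => (y : ℝ) * (l ^ y / (y.factorial : ℝ) ^ ν)) := by
  have hle : ∀ y : ℕ, l ^ y / (y.factorial : ℝ) ^ ν ≤ l ^ y / (y.factorial : ℝ) := fun y => by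
    have h1 : (1 : ℝ) ≤ y.factorial := by exact_mod_cast y.factorial_pos
    have h2 := Real.self_le_rpow_of_one_le h1 hν
    gcongr
  refine ⟨Summable.of_nonneg_of_le (fun y => by positivity) hle
    (Real.summable_pow_div_factorial l), Summable.of_nonneg_of_le (fun y => by positivity)
    (fun y => ?_) (Real.summable_pow_div_factorial (2 * l))⟩
  have h2 : (y : ℝ) ≤ 2 ^ y := by exact_mod_cast y.lt_two_pow_self.le
  calc (y : ℝ) * (l ^ y / (y.factorial : ℝ) ^ ν) ≤ 2 ^ y * (l ^ y / (y.factorial : ℝ)) := by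
        exact mul_le_mul h2 (hle y) (by positivity) (by positivity)
    _ = (2 * l) ^ y / (y.factorial : ℝ) := by rw [mul_pow]; ring

lemma cmpZ_pos {l ν : ℝ} (hl : 0 < l) (hν : 1 ≤ ν) : 0 < cmpZ l ν :=
  (summable_cmp_terms hl hν).1.tsum_pos (fun y => by positivity) 0 (by positivity)

lemma cmpPmf_nonneg {l ν : ℝ} (hl : 0 < l) (hν : 1 ≤ ν) (y : ℕ) : 0 ≤ cmpPmf l ν y := by
  have := cmpZ_pos hl hν
  unfold cmpPmf
  positivity

lemma hasSum_cmpPmf {l ν : ℝ} (hl : 0 < l) (hν : 1 ≤ ν) : HasSum (cmpPmf l ν) 1 := by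
  have h := (summable_cmp_terms hl hν).1.hasSum.div_const (cmpZ l ν)
  rwa [← cmpZ, div_self (cmpZ_pos hl hν).ne'] at h

lemma hasSum_mul_cmpPmf {μ l ν : ℝ} (hl : 0 < l) (hν : 1 ≤ ν) (h : meanConstraint μ l ν) :
    HasSum (fun y : ℕ => (y : ℝ) * cmpPmf l ν y) μ := by
  obtain ⟨hs0, hs1⟩ := summable_cmp_terms hl hν
  have hs : HasSum (fun y : ℕ => ((y : ℝ) - μ) * l ^ y / (y.factorial : ℝ) ^ ν) 0 := by
    have h2 : Summable (fun y : ℕ => ((y : ℝ) - μ) * l ^ y / (y.factorial : ℝ) ^ ν) :=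
      (hs1.sub (hs0.mul_left μ)).congr (fun y => by ring)
    have h3 := h2.hasSum
    rwa [h] at h3
  have h4 := (hs.div_const (cmpZ l ν)).add ((hasSum_cmpPmf hl hν).mul_left μ)
  rw [zero_div, zero_add, mul_one] at h4
  refine h4.congr_forall (fun y => ?_)
  unfold cmpPmf
  ring

lemma cmpPmf_succ_mul {l ν : ℝ} (y : ℕ) :
    cmpPmf l ν (y + 1) * ((y : ℝ) + 1) ^ ν = l * cmpPmf l ν y := by
  have h1 : (0 : ℝ) < ((y : ℝ) + 1) ^ ν := by positivity
  have h2 : (0 : ℝ) < (y.factorial : ℝ) ^ ν := by positivity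
  unfold cmpPmf
  rw [Nat.factorial_succ, Nat.cast_mul, Real.mul_rpow (by positivity) (by positivity), pow_succ]
  push_cast
  field_simp

lemma cmpPmf_mul_le {l ν r : ℝ} (hl : 0 < l) (hν : 1 ≤ ν) {y k : ℕ}
    (hr : ((y : ℝ) + 1) ≤ r * ((k : ℝ) + 1)) (hr0 : 0 ≤ r) :
    cmpPmf l ν y * cmpPmf l ν (k + 1) ≤ r ^ ν * (cmpPmf l ν (y + 1) * cmpPmf l ν k) := by
  have hk : (0 : ℝ) < ((k : ℝ) + 1) ^ ν := by positivity
  have hpow : ((y : ℝ) + 1) ^ ν ≤ r ^ ν * ((k : ℝ) + 1) ^ ν := by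
    rw [← Real.mul_rpow hr0 (by positivity)]
    exact Real.rpow_le_rpow (by positivity) hr (by linarith)
  have hy1 := cmpPmf_nonneg hl hν (y + 1)
  have hk0 := cmpPmf_nonneg hl hν k
  refine le_of_mul_le_mul_right ?_ hk
  calc cmpPmf l ν y * cmpPmf l ν (k + 1) * ((k : ℝ) + 1) ^ ν
      = (l * cmpPmf l ν y) * cmpPmf l ν k := by rw [mul_assoc, cmpPmf_succ_mul]; ring
    _ = (cmpPmf l ν (y + 1) * cmpPmf l ν k) * ((y : ℝ) + 1) ^ ν := by
        rw [← cmpPmf_succ_mul]; ring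
    _ ≤ (cmpPmf l ν (y + 1) * cmpPmf l ν k) * (r ^ ν * ((k : ℝ) + 1) ^ ν) := by gcongr
    _ = _ := by ring

/-- A probability mass function on `ℕ` with mean `μ ∈ (n, n + 1)` satisfies
`(μ - n) (n + 1 - μ) ≤ E (Y - μ)⁺ = E (μ - Y)⁺`. -/
lemma exists_hasSum_pos_part {p : ℕ → ℝ} {μ : ℝ} {n : ℕ} (hp : ∀ y, 0 ≤ p y) (h0 : HasSum p 1)
    (h1 : HasSum (fun y : ℕ => (y : ℝ) * p y) μ) (hn : (n : ℝ) < μ) (hn' : μ < n + 1) :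
    ∃ T, (μ - n) * (n + 1 - μ) ≤ T ∧ HasSum (fun y : ℕ => max ((y : ℝ) - μ) 0 * p y) T ∧
      HasSum (fun y : ℕ => max (μ - (y : ℝ)) 0 * p y) T := by
  have hμ : 0 < μ := n.cast_nonneg.trans_lt hn
  have hs : Summable (fun y : ℕ => max ((y : ℝ) - μ) 0 * p y) := by
    refine Summable.of_nonneg_of_le (fun y => mul_nonneg (le_max_right _ _) (hp y))
      (fun y => mul_le_mul_of_nonneg_right (max_le (by linarith) (by positivity)) (hp y))
      h1.summable
  have hA := hs.hasSum
  set T := ∑' y : ℕ, max ((y : ℝ) - μ) 0 * p y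
  have hB : HasSum (fun y : ℕ => max (μ - (y : ℝ)) 0 * p y) T := by
    have h := hA.add ((h0.mul_left μ).sub h1)
    rw [mul_one, sub_self, add_zero] at h
    refine h.congr_forall (fun y => ?_)
    rcases le_total (y : ℝ) μ with hy | hy
    · rw [max_eq_right (sub_nonpos.2 hy), max_eq_left (sub_nonneg.2 hy)]; ring
    · rw [max_eq_left (sub_nonneg.2 hy), max_eq_right (sub_nonpos.2 hy)]; ring
  refine ⟨T, ?_, hA, hB⟩
  have h := hasSum_le (fun y => ?_) (h0.mul_left ((μ - n) * (n + 1 - μ)))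
    ((hB.mul_left (n + 1 - μ)).add (hA.mul_left (μ - n)))
  · linarith
  · rw [← mul_assoc, ← mul_assoc, ← add_mul]
    refine mul_le_mul_of_nonneg_right ?_ (hp y)
    rcases le_or_gt y n with hy | hy
    · have : (y : ℝ) ≤ n := by exact_mod_cast hy
      rw [max_eq_left (by linarith), max_eq_right (by linarith)]
      nlinarith
    · have : (n : ℝ) + 1 ≤ y := by exact_mod_cast hy
      rw [max_eq_right (by linarith), max_eq_left (by linarith)]
      nlinarith

/-- Quantitative concentration of a strongly log-concave probability mass function on the two
integers adjacent to its mean. -/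
lemma abs_sub_le_of_mul_le {p : ℕ → ℝ} {μ ε : ℝ} {n : ℕ} (hp : ∀ y, 0 ≤ p y) (h0 : HasSum p 1)
    (h1 : HasSum (fun y : ℕ => (y : ℝ) * p y) μ) (hn : (n : ℝ) < μ) (hn' : μ < n + 1)
    (hε : 0 ≤ ε) (h : ∀ y k, y ≤ n → n ≤ k → (y ≠ n ∨ k ≠ n) →
      p y * p (k + 1) ≤ ε * (p (y + 1) * p k)) :
    let C := (μ + 1) / ((μ - n) * (n + 1 - μ)) * (2 * μ + 2 * n + 2)
    |p n - (1 - (μ - n))| ≤ C * ε ∧ |p (n + 1) - (μ - n)| ≤ C * ε ∧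
      ∀ y, y ≠ n → y ≠ n + 1 → p y ≤ C * ε := by
  intro C
  have hμ : 0 < μ := n.cast_nonneg.trans_lt hn
  obtain ⟨T, hT, hA, hB⟩ := exists_hasSum_pos_part hp h0 h1 hn hn'
  set d := (μ - n) * (n + 1 - μ) with hd
  have hd0 : 0 < d := mul_pos (by linarith) (by linarith)
  have hS0 : HasSum (fun y => p (y + 1)) (1 - p 0) := by
    simpa using (hasSum_nat_add_iff' 1).2 h0
  have hS1 : HasSum (fun y : ℕ => ((y : ℝ) + 1) * p (y + 1)) μ := by
    simpa using (hasSum_nat_add_iff' 1).2 h1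
  have hM : HasSum (fun y : ℕ => ((y : ℝ) + 1) * p y) (μ + 1) :=
    (h1.add h0).congr_forall (fun y => by ring)
  set K := (μ + 1) / d * ε with hK
  have hK0 : 0 ≤ K := by positivity
  have hleft : ∀ y < n, p y ≤ K * p (y + 1) := fun y hy => by
    have hA' : HasSum (fun k : ℕ => max (((k + 1 : ℕ) : ℝ) - μ) 0 * p (k + 1)) T := by
      simpa [hμ.le] using (hasSum_nat_add_iff' 1).2 hA
    have hle := hasSum_le (fun k => ?_) (hA'.mul_left (p y)) (hM.mul_left (ε * p (y + 1)))
    · have : p y * d ≤ p y * T := mul_le_mul_of_nonneg_left hT (hp y)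
      rw [hK, div_mul_eq_mul_div, div_mul_eq_mul_div, le_div_iff₀ hd0]
      linarith
    · rcases le_or_gt n k with hk | hk
      · have h2 := h y k hy.le hk (Or.inl hy.ne)
        have h3 : max (((k + 1 : ℕ) : ℝ) - μ) 0 ≤ (k : ℝ) + 1 :=
          max_le (by push_cast; linarith) (by positivity)
        have h4 : 0 ≤ p y * p (k + 1) := mul_nonneg (hp _) (hp _)
        calc p y * (max (((k + 1 : ℕ) : ℝ) - μ) 0 * p (k + 1))
            = max (((k + 1 : ℕ) : ℝ) - μ) 0 * (p y * p (k + 1)) := by ring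
          _ ≤ ((k : ℝ) + 1) * (ε * (p (y + 1) * p k)) := by gcongr
          _ = _ := by ring
      · have : ((k + 1 : ℕ) : ℝ) ≤ n := by exact_mod_cast hk
        rw [max_eq_right (by linarith)]
        have := hp k
        have := hp (y + 1)
        simp only [zero_mul, mul_zero]
        positivity
  have hright : ∀ k, n < k → p (k + 1) ≤ K * p k := fun k hk => by
    have hle := hasSum_le (fun y => ?_) (hB.mul_left (p (k + 1))) (hS0.mul_left (ε * p k * μ))
    · have h2 : p (k + 1) * d ≤ p (k + 1) * T := mul_le_mul_of_nonneg_left hT (hp _)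
      have h3 : 0 ≤ ε * p k := mul_nonneg hε (hp _)
      have h4 : 0 ≤ ε * p k * μ * p 0 := mul_nonneg (mul_nonneg h3 hμ.le) (hp _)
      rw [hK, div_mul_eq_mul_div, div_mul_eq_mul_div, le_div_iff₀ hd0]
      linarith
    · have hpk := hp k
      have hpy := hp (y + 1)
      rcases le_or_gt y n with hy | hy
      · have h2 := h y k hy hk.le (Or.inr hk.ne')
        have h3 : max (μ - (y : ℝ)) 0 ≤ μ := max_le (by simp) hμ.le
        have h4 : 0 ≤ p y * p (k + 1) := mul_nonneg (hp _) (hp _)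
        calc p (k + 1) * (max (μ - (y : ℝ)) 0 * p y)
            = max (μ - (y : ℝ)) 0 * (p y * p (k + 1)) := by ring
          _ ≤ μ * (ε * (p (y + 1) * p k)) := by gcongr
          _ = _ := by ring
      · have : (n : ℝ) + 1 ≤ y := by exact_mod_cast hy
        rw [max_eq_right (by linarith)]
        simp only [zero_mul, mul_zero]
        positivity
  let g : ℕ → ℝ := fun y => y.casesOn 0 (fun k => ((k : ℝ) + n + 2) * p k)
  have hg : HasSum g (μ + n + 2) := by
    refine (hasSum_nat_add_iff' 1).1 ?_
    have h2 := h1.add (h0.mul_left ((n : ℝ) + 2))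
    rw [mul_one, ← add_assoc] at h2
    rw [Finset.sum_range_one, show g 0 = 0 from rfl, sub_zero]
    change HasSum (fun k : ℕ => ((k : ℝ) + n + 2) * p k) _
    exact h2.congr_forall (fun y => by ring)
  have hg0 : ∀ y, 0 ≤ g y := fun y => by
    rcases y with _ | k
    · exact le_rfl
    · exact mul_nonneg (by positivity) (hp k)
  have hG : HasSum (fun y : ℕ => K * (((y : ℝ) + n + 1) * p (y + 1) + g y))
      (K * ((μ + n * (1 - p 0)) + (μ + n + 2))) :=
    (((hS1.add (hS0.mul_left (n : ℝ))).congr_forall (fun y => by ring)).add hg).mul_left K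
  have hGle : K * ((μ + n * (1 - p 0)) + (μ + n + 2)) ≤ C * ε := by
    have h2 : C * ε = K * (2 * μ + 2 * n + 2) := by simp only [C, hK]; ring
    have h3 : 0 ≤ (n : ℝ) * p 0 := mul_nonneg (by positivity) (hp 0)
    rw [h2]
    exact mul_le_mul_of_nonneg_left (by linarith) hK0
  have hG0 : ∀ y : ℕ, 0 ≤ K * (((y : ℝ) + n + 1) * p (y + 1) + g y) := fun y =>
    mul_nonneg hK0 (add_nonneg (mul_nonneg (by positivity) (hp _)) (hg0 y))
  have hbound : ∀ y : ℕ, y ≠ n → y ≠ n + 1 →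
      ((y : ℝ) + n + 1) * p y ≤ K * (((y : ℝ) + n + 1) * p (y + 1) + g y) := fun y hy hy' => by
    rcases lt_or_gt_of_ne hy with hlt | hgt
    · have h2 := mul_le_mul_of_nonneg_left (hleft y hlt) (by positivity : 0 ≤ (y : ℝ) + n + 1)
      have h3 := mul_nonneg hK0 (hg0 y)
      linarith
    · obtain ⟨k, rfl⟩ : ∃ k, y = k + 1 := ⟨y - 1, by omega⟩
      have h2 := mul_le_mul_of_nonneg_left (hright k (by omega))
        (by positivity : 0 ≤ (((k + 1 : ℕ) : ℝ)) + n + 1)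
      have h3 : 0 ≤ K * (((((k + 1 : ℕ) : ℝ)) + n + 1) * p (k + 1 + 1)) :=
        mul_nonneg hK0 (mul_nonneg (by positivity) (hp _))
      have h4 : g (k + 1) = ((k : ℝ) + n + 2) * p k := rfl
      rw [mul_add, h4]
      push_cast at h2 h3 ⊢
      linarith
  have habs : ∀ (c : ℕ → ℝ) (m : ℕ) (s : ℝ), HasSum (fun y => c y * p y) s → c m = 1 →
      (∀ y, |c y| ≤ (y : ℝ) + n + 1) → (∀ y, y ≠ m → y = n ∨ y = n + 1 → c y = 0) →
      (m = n ∨ m = n + 1) → |p m - s| ≤ C * ε := fun c m s hs hcm hc hc0 hm => by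
    have h2 := hs.sub (hasSum_ite_eq m (p m))
    have h3 : ∀ y, |c y * p y - (if y = m then p m else 0)| ≤
        K * (((y : ℝ) + n + 1) * p (y + 1) + g y) := fun y => by
      by_cases hy : y = m
      · subst hy
        simpa [hcm] using hG0 y
      · rw [if_neg hy, sub_zero, abs_mul, abs_of_nonneg (hp y)]
        by_cases hy2 : y = n ∨ y = n + 1
        · rw [hc0 y hy hy2]
          simpa using hG0 y
        · push Not at hy2
          exact (mul_le_mul_of_nonneg_right (hc y) (hp y)).trans (hbound y hy2.1 hy2.2)
    have h4 := hasSum_le (fun y => (abs_le.1 (h3 y)).2) h2 hG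
    have h5 := hasSum_le (fun y => (abs_le.1 (h3 y)).1) hG.neg h2
    rw [abs_le]
    constructor <;> linarith
  refine ⟨habs (fun y => (n : ℝ) + 1 - y) n _ ?_ (by simp) (fun y => ?_) ?_ (Or.inl rfl),
    habs (fun y => (y : ℝ) - n) (n + 1) _ ?_ (by simp) (fun y => ?_) ?_ (Or.inr rfl),
    fun y hy hy' => ?_⟩
  · have h2 := (h0.mul_left ((n : ℝ) + 1)).sub h1
    rw [show ((n : ℝ) + 1) * 1 - μ = 1 - (μ - n) by ring] at h2
    exact h2.congr_forall (fun y => by ring)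
  · rw [abs_le]
    constructor <;> linarith [(y.cast_nonneg : (0 : ℝ) ≤ y), (n.cast_nonneg : (0 : ℝ) ≤ n)]
  · rintro y hy (rfl | rfl)
    · exact absurd rfl hy
    · push_cast; ring
  · have h2 := h1.sub (h0.mul_left (n : ℝ))
    rw [mul_one] at h2
    exact h2.congr_forall (fun y => by ring)
  · rw [abs_le]
    constructor <;> linarith [(y.cast_nonneg : (0 : ℝ) ≤ y), (n.cast_nonneg : (0 : ℝ) ≤ n)]
  · rintro y hy (rfl | rfl)
    · exact sub_self _
    · exact absurd rfl hy
  · have h2 := (hbound y hy hy').trans ((le_hasSum hG y (fun z _ => hG0 z)).trans hGle)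
    have h3 : 0 ≤ ((y : ℝ) + n) * p y := mul_nonneg (by positivity) (hp y)
    linarith

/-- For non-integer mean `μ > 0` with fractional part `Δ = μ − ⌊μ⌋`, the
mean-parametrized CMP converges to the shifted Bernoulli on `⌊μ⌋, ⌈μ⌉` with
probabilities `1 − Δ` and `Δ`, all other probabilities tending to 0. -/
theorem stmt1 (μ : ℝ) (hμ : 0 < μ) (hni : ¬ ∃ n : ℤ, (n : ℝ) = μ) (lam : ℝ → ℝ)
    (hlam : ∀ ν : ℝ, 0 < ν → 0 < lam ν ∧ meanConstraint μ (lam ν) ν) :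
    Tendsto (fun ν : ℝ => cmpPmf (lam ν) ν ⌊μ⌋₊) atTop (𝓝 (1 - (μ - ⌊μ⌋₊))) ∧
    Tendsto (fun ν : ℝ => cmpPmf (lam ν) ν ⌈μ⌉₊) atTop (𝓝 (μ - ⌊μ⌋₊)) ∧
    ∀ y : ℕ, y ≠ ⌊μ⌋₊ → y ≠ ⌈μ⌉₊ →
      Tendsto (fun ν : ℝ => cmpPmf (lam ν) ν y) atTop (𝓝 0) := by
  have hn : ((⌊μ⌋₊ : ℕ) : ℝ) < μ :=
    lt_of_le_of_ne (Nat.floor_le hμ.le) (fun h => hni ⟨(⌊μ⌋₊ : ℤ), by exact_mod_cast h⟩)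
  have hn' : μ < ⌊μ⌋₊ + 1 := Nat.lt_floor_add_one μ
  have hceil : ⌈μ⌉₊ = ⌊μ⌋₊ + 1 := by
    rw [Nat.ceil_eq_iff (by omega)]
    exact ⟨by simpa using hn, by push_cast; exact hn'.le⟩
  rw [hceil]
  set n := ⌊μ⌋₊
  set r : ℝ := ((n : ℝ) + 1) / (n + 2) with hr
  have hr0 : 0 < r := by positivity
  have hr1 : r < 1 := by rw [hr, div_lt_one (by positivity)]; linarith
  have key := fun (ν : ℝ) (hν : 1 ≤ ν) =>
    have hl := hlam ν (by linarith)
    abs_sub_le_of_mul_le (cmpPmf_nonneg hl.1 hν) (hasSum_cmpPmf hl.1 hν)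
      (hasSum_mul_cmpPmf hl.1 hν hl.2) hn hn' (Real.rpow_nonneg hr0.le ν)
      (fun y k hy hk hyk => cmpPmf_mul_le hl.1 hν (r := r) (by
        have hy1 : (y : ℝ) ≤ n := by exact_mod_cast hy
        have hk1 : (n : ℝ) ≤ k := by exact_mod_cast hk
        have hn0 : (0 : ℝ) ≤ n := n.cast_nonneg
        rw [hr, div_mul_eq_mul_div, le_div_iff₀ (by positivity)]
        rcases hyk with hlt | hlt
        · have : (y : ℝ) + 1 ≤ n := by exact_mod_cast lt_of_le_of_ne hy hlt
          nlinarith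
        · have : (n : ℝ) + 1 ≤ k := by exact_mod_cast lt_of_le_of_ne hk hlt.symm
          nlinarith) hr0.le)
  set C := (μ + 1) / ((μ - n) * (n + 1 - μ)) * (2 * μ + 2 * n + 2)
  have hlim : Tendsto (fun ν : ℝ => C * r ^ ν) atTop (𝓝 0) := by
    simpa using (tendsto_rpow_atTop_of_base_lt_one r (by linarith) hr1).const_mul C
  have hev := eventually_ge_atTop (1 : ℝ)
  refine ⟨?_, ?_, fun y hy hy' => ?_⟩
  · rw [tendsto_iff_dist_tendsto_zero]
    exact squeeze_zero' (Eventually.of_forall fun _ => dist_nonneg)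
      (hev.mono fun ν hν => (key ν hν).1) hlim
  · rw [tendsto_iff_dist_tendsto_zero]
    exact squeeze_zero' (Eventually.of_forall fun _ => dist_nonneg)
      (hev.mono fun ν hν => (key ν hν).2.1) hlim
  · exact squeeze_zero' (hev.mono fun ν hν => cmpPmf_nonneg (hlam ν (by linarith)).1 hν y)
      (hev.mono fun ν hν => (key ν hν).2.2 y hy hy') hlim
end

section
/- Let μ > 0 be a non-integer real number and set Δ = μ − ⌊μ⌋ ∈ (0,1). Suppose for each ν > 0, λ(ν) > 0 satisfies the mean constraint Σ_{y=0}^∞ (y − μ) λ(ν)^y/(y!)^ν = 0. Then for all sufficiently large ν, Δ·⌈μ⌉^ν < λ(ν) < (1 − Δ)^{−1}·⌈μ⌉^ν. -/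
open Filter Real Topology

/-- Up to `n = m`, the sequence `m ^ n / n!` is nondecreasing. -/
lemma pow_div_factorial_le_of_le {m y n : ℕ} (hy : y ≤ n) (hn : n ≤ m) :
    (m : ℝ) ^ y / y.factorial ≤ (m : ℝ) ^ n / n.factorial := by
  induction n, hy using Nat.le_induction with
  | base => exact le_rfl
  | succ n _ ih =>
    refine (ih (by omega)).trans ?_
    have hm : ((n : ℝ) + 1) ≤ m := by exact_mod_cast hn
    have hn0 : (0 : ℝ) < n + 1 := by positivity
    have hstep : (m : ℝ) ^ (n + 1) / (n + 1).factorial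
        = (m : ℝ) ^ n / n.factorial * (m / (n + 1)) := by
      rw [Nat.factorial_succ, pow_succ]; push_cast; field_simp
    rw [hstep]
    exact le_mul_of_one_le_right (by positivity) ((one_le_div hn0).2 hm)

/-- From `n = m` on, the sequence `m ^ n / n!` is nonincreasing. -/
lemma pow_div_factorial_le_of_ge {m n y : ℕ} (hn : m ≤ n) (hy : n ≤ y) :
    (m : ℝ) ^ y / y.factorial ≤ (m : ℝ) ^ n / n.factorial := by
  induction y, hy using Nat.le_induction with
  | base => exact le_rfl
  | succ y hy ih =>
    refine le_trans ?_ ih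
    have hm : (m : ℝ) ≤ y + 1 := by exact_mod_cast (by omega : m ≤ y + 1)
    have hstep : (m : ℝ) ^ (y + 1) / (y + 1).factorial
        = (m : ℝ) ^ y / y.factorial * (m / (y + 1)) := by
      rw [Nat.factorial_succ, pow_succ]; push_cast; field_simp
    rw [hstep]
    exact mul_le_of_le_one_right (by positivity) ((div_le_one (by positivity)).2 hm)

/-- Away from its two maximizers `k` and `k + 1`, the sequence `(k + 1) ^ y / y!` is smaller than
its maximum by a factor `(k + 1) / (k + 2)` at least. -/
lemma pow_div_factorial_le_mul {k y : ℕ} (h₁ : y ≠ k) (h₂ : y ≠ k + 1) :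
    ((k + 1 : ℕ) : ℝ) ^ y / y.factorial
      ≤ ((k : ℝ) + 1) / (k + 2) * (((k + 1 : ℕ) : ℝ) ^ k / k.factorial) := by
  rcases lt_or_gt_of_ne h₁ with h | h
  · obtain ⟨j, rfl⟩ : ∃ j, k = j + 1 := ⟨k - 1, by omega⟩
    refine (pow_div_factorial_le_of_le (n := j) (by omega) (by omega)).trans ?_
    rw [Nat.factorial_succ, pow_succ]
    push_cast
    have hj : (0 : ℝ) < j.factorial := by positivity
    have hone : (1 : ℝ) ≤ ((j : ℝ) + 1 + 1) / (j + 1 + 2) * ((j + 1 + 1) / (j + 1)) := by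
      rw [div_mul_div_comm, one_le_div (by positivity)]
      nlinarith
    calc ((j : ℝ) + 1 + 1) ^ j / j.factorial
        ≤ ((j : ℝ) + 1 + 1) ^ j / j.factorial
          * (((j : ℝ) + 1 + 1) / (j + 1 + 2) * ((j + 1 + 1) / (j + 1))) :=
          le_mul_of_one_le_right (by positivity) hone
      _ = _ := by field_simp
  · refine (pow_div_factorial_le_of_ge (n := k + 2) (by omega) (by omega)).trans_eq ?_
    rw [Nat.factorial_succ, Nat.factorial_succ, pow_succ, pow_succ]
    push_cast
    field_simp
    ring

/-- The terms of the mean constraint are summable for `ν ≥ 1`. -/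
lemma summable_meanConstraint_terms (μ : ℝ) {l ν : ℝ} (hl : 0 < l) (hν : 1 ≤ ν) :
    Summable fun y : ℕ => ((y : ℝ) - μ) * l ^ y / (y.factorial : ℝ) ^ ν := by
  refine Summable.of_norm_bounded
    (g := fun y : ℕ => (2 * l) ^ y / y.factorial + |μ| * (l ^ y / y.factorial))
    ((Real.summable_pow_div_factorial _).add
      ((Real.summable_pow_div_factorial _).mul_left _)) fun y => ?_
  have hf : (1 : ℝ) ≤ y.factorial := by exact_mod_cast Nat.one_le_iff_ne_zero.2 y.factorial_ne_zero
  have hpow : (y.factorial : ℝ) ≤ (y.factorial : ℝ) ^ ν := Real.self_le_rpow_of_one_le hf hν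
  have hy : (y : ℝ) ≤ 2 ^ y := by exact_mod_cast Nat.lt_two_pow_self.le
  have habs : |(y : ℝ) - μ| ≤ 2 ^ y + |μ| := by
    refine (abs_sub _ _).trans ?_
    rw [Nat.abs_cast]
    gcongr
  rw [Real.norm_eq_abs, abs_div, abs_mul, abs_of_pos (pow_pos hl y),
    abs_of_pos (by positivity : (0 : ℝ) < (y.factorial : ℝ) ^ ν)]
  calc |(y : ℝ) - μ| * l ^ y / (y.factorial : ℝ) ^ ν
      ≤ (2 ^ y + |μ|) * l ^ y / y.factorial := by gcongr
    _ = _ := by rw [mul_pow]; ring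

/-- With `l = r m ^ ν`, the CMP weight of `y` is `r ^ y (m ^ y / y!) ^ ν`. -/
lemma cmp_weight_eq (r ν : ℝ) (m y : ℕ) :
    (r * (m : ℝ) ^ ν) ^ y / (y.factorial : ℝ) ^ ν
      = r ^ y * ((m : ℝ) ^ y / y.factorial) ^ ν := by
  rw [Real.div_rpow (by positivity) (by positivity), mul_pow, ← Real.rpow_mul_natCast (by positivity),
    ← Real.rpow_natCast_mul (by positivity), mul_comm ν, mul_div_assoc]

section Weights

variable {k : ℕ} {μ r ν q A : ℝ} {w : ℕ → ℝ}

/-- If `w` has the shape of CMP weights with `w (k + 1) / w k = r ≤ μ - k < 1`, and the other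
weights are relatively small, then the mean of `w` is below `μ`. -/
lemma tsum_sub_mul_neg (hk : (k : ℝ) < μ) (hk1 : μ < k + 1) (hr : 0 < r) (hA : 0 < A)
    (hw : ∀ y, 0 ≤ w y) (hwk : w k = r ^ k * A) (hwm : w (k + 1) = r ^ (k + 1) * A)
    (hwq : ∀ y, y ≠ k → y ≠ k + 1 → w y ≤ r ^ y * (q * A)) (hq : 0 ≤ q)
    (hs : Summable fun y : ℕ => ((y : ℝ) - μ) * w y) (hrΔ : r ≤ μ - k)
    (hqC : q * ∑' y : ℕ, (y : ℝ) * (μ - k) ^ (y - k) < (μ - k) ^ 2) :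
    ∑' y : ℕ, ((y : ℝ) - μ) * w y < 0 := by
  set Δ := μ - k with hΔ
  have hΔ0 : 0 < Δ := by linarith
  have hΔ1 : Δ < 1 := by linarith
  have hμ : 0 < μ := lt_of_le_of_lt (Nat.cast_nonneg k) hk
  have hC : Summable fun y : ℕ => (y : ℝ) * Δ ^ (y - k) := by
    have h := (summable_pow_mul_geometric_of_norm_lt_one 1
      (r := Δ) (by rwa [Real.norm_of_nonneg hΔ0.le])).mul_left ((Δ ^ k)⁻¹)
    refine (summable_nat_add_iff k).1 (((summable_nat_add_iff k).2 h).congr fun y => ?_)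
    rw [pow_one, Nat.add_sub_cancel, pow_add]
    field_simp
  have hg := (((hasSum_ite_eq k (-Δ)).add (hasSum_ite_eq (k + 1) ((1 - Δ) * Δ))).add
    (hC.hasSum.mul_left q)).mul_left (r ^ k * A)
  have hle := hasSum_le (fun y => ?_) hs.hasSum hg
  · refine hle.trans_lt (mul_neg_of_pos_of_neg (by positivity) ?_)
    nlinarith
  · have hrest : 0 ≤ q * ((y : ℝ) * Δ ^ (y - k)) := by positivity
    by_cases h₁ : y = k
    · subst h₁
      simp only [if_true, (Nat.succ_ne_self y).symm, if_false, hwk]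
      nlinarith [mul_nonneg (by positivity : 0 ≤ r ^ y * A) hrest]
    by_cases h₂ : y = k + 1
    · subst h₂
      simp only [if_true, h₁, if_false, hwm]
      have h : ((k + 1 : ℕ) : ℝ) - μ = 1 - Δ := by push_cast; linarith
      rw [h, pow_succ]
      have hr' : (1 - Δ) * r ≤ (1 - Δ) * Δ := mul_le_mul_of_nonneg_left hrΔ (by linarith)
      calc (1 - Δ) * (r ^ k * r * A) = r ^ k * A * ((1 - Δ) * r) := by ring
        _ ≤ _ := mul_le_mul_of_nonneg_left (by linarith) (by positivity)
    simp only [h₁, h₂, if_false, zero_add]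
    rcases lt_or_gt_of_ne h₁ with h | h
    · have hy : (y : ℝ) < k := by exact_mod_cast h
      exact (mul_nonpos_of_nonpos_of_nonneg (by linarith) (hw y)).trans (by positivity)
    · have hrp : r ^ (y - k) ≤ Δ ^ (y - k) := pow_le_pow_left₀ hr.le hrΔ _
      have hry : r ^ y = r ^ k * r ^ (y - k) := by rw [← pow_add]; congr 1; omega
      calc ((y : ℝ) - μ) * w y ≤ y * w y :=
            mul_le_mul_of_nonneg_right (by linarith) (hw y)
        _ ≤ y * (r ^ y * (q * A)) := by gcongr; exact hwq y h₁ h₂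
        _ = y * (r ^ k * r ^ (y - k) * (q * A)) := by rw [hry]
        _ ≤ y * (r ^ k * Δ ^ (y - k) * (q * A)) := by gcongr
        _ = _ := by ring

/-- If `w` has the shape of CMP weights with `w (k + 1) / w k = r ≥ (1 - (μ - k))⁻¹`, and the other
weights are relatively small, then the mean of `w` is above `μ`. -/
lemma tsum_sub_mul_pos (hk : (k : ℝ) < μ) (hk1 : μ < k + 1) (hA : 0 < A)
    (hw : ∀ y, 0 ≤ w y) (hwk : w k = r ^ k * A) (hwm : w (k + 1) = r ^ (k + 1) * A)
    (hwq : ∀ y, y ≠ k → y ≠ k + 1 → w y ≤ r ^ y * (q * A)) (hq : 0 ≤ q)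
    (hs : Summable fun y : ℕ => ((y : ℝ) - μ) * w y) (hrΔ : (1 - (μ - k))⁻¹ ≤ r)
    (hqC : q * (k * μ) < 1 - (μ - k)) :
    0 < ∑' y : ℕ, ((y : ℝ) - μ) * w y := by
  set Δ := μ - k with hΔ
  have hΔ0 : 0 < Δ := by linarith
  have hΔ1 : 0 < 1 - Δ := by linarith
  have hμ : 0 < μ := lt_of_le_of_lt (Nat.cast_nonneg k) hk
  have hr1 : 1 ≤ r := ((one_le_inv₀ hΔ1).2 (by linarith)).trans hrΔ
  have hr : 1 ≤ (1 - Δ) * r := by rwa [inv_le_iff_one_le_mul₀' hΔ1] at hrΔ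
  have hC : HasSum (fun y : ℕ => if y < k then μ else 0) (k * μ) := by
    have h : HasSum _ _ := hasSum_sum_of_ne_finset_zero (L := .unconditional ℕ) (f := fun y : ℕ => if y < k then μ else 0)
      (s := Finset.range k) fun y hy => by simp_all
    rwa [Finset.sum_congr rfl fun y hy => if_pos (Finset.mem_range.1 hy), Finset.sum_const,
      Finset.card_range, nsmul_eq_mul] at h
  have hg := (((hasSum_ite_eq k (-Δ)).add (hasSum_ite_eq (k + 1) (1 : ℝ))).sub
    (hC.mul_left q)).mul_left (r ^ k * A)
  have hle := hasSum_le (fun y => ?_) hg hs.hasSum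
  · refine lt_of_lt_of_le (mul_pos (by positivity) ?_) hle
    linarith
  · by_cases h₁ : y = k
    · subst h₁
      simp only [if_true, (Nat.succ_ne_self y).symm, if_false, hwk, lt_irrefl]
      exact le_of_eq (by rw [hΔ]; ring)
    by_cases h₂ : y = k + 1
    · subst h₂
      have h : ((k + 1 : ℕ) : ℝ) - μ = 1 - Δ := by push_cast; linarith
      simp only [if_true, h₁, if_false, hwm, not_lt.2 k.le_succ, h, pow_succ]
      calc r ^ k * A * (0 + 1 - q * 0) = r ^ k * A * 1 := by ring
        _ ≤ r ^ k * A * ((1 - Δ) * r) := mul_le_mul_of_nonneg_left hr (by positivity)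
        _ = _ := by ring
    rcases lt_or_gt_of_ne h₁ with h | h
    · simp only [h₁, h₂, if_false, h, if_true]
      have hwy : w y ≤ r ^ k * (q * A) :=
        (hwq y h₁ h₂).trans (by gcongr)
      have hy : (0 : ℝ) ≤ y := Nat.cast_nonneg y
      nlinarith [mul_le_mul_of_nonneg_left hwy hμ.le, mul_nonneg hy (hw y)]
    · have hy : (k : ℝ) + 1 ≤ y := by exact_mod_cast h
      simp only [h₁, h₂, if_false, not_lt.2 h.le, add_zero, mul_zero, sub_zero]
      exact mul_nonneg (by linarith) (hw y)

end Weights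


/-- Lemma 2: for non-integer `μ > 0` with `Δ = μ − ⌊μ⌋`, the solution `λ(ν)` of the
mean constraint satisfies `Δ⌈μ⌉^ν < λ(ν) < (1−Δ)⁻¹⌈μ⌉^ν` for sufficiently large `ν`. -/
theorem stmt3 (μ : ℝ) (hμ : 0 < μ) (hni : ¬ ∃ n : ℤ, (n : ℝ) = μ) (lam : ℝ → ℝ)
    (hlam : ∀ ν : ℝ, 0 < ν → 0 < lam ν ∧ meanConstraint μ (lam ν) ν) :
    ∀ᶠ ν in (atTop : Filter ℝ),
      (μ - ⌊μ⌋₊) * (⌈μ⌉₊ : ℝ) ^ ν < lam ν ∧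
      lam ν < (1 - (μ - ⌊μ⌋₊))⁻¹ * (⌈μ⌉₊ : ℝ) ^ ν := by
  set k := ⌊μ⌋₊ with hk_def
  have hk : (k : ℝ) < μ := lt_of_le_of_ne (Nat.floor_le hμ.le) fun h => hni ⟨k, by exact_mod_cast h⟩
  have hk1 : μ < k + 1 := Nat.lt_floor_add_one μ
  have hceil : ⌈μ⌉₊ = k + 1 := by
    rw [Nat.ceil_eq_iff k.succ_ne_zero]
    exact ⟨by simpa using hk, by exact_mod_cast hk1.le⟩
  rw [hceil]
  have hq0 : (0 : ℝ) < ((k : ℝ) + 1) / (k + 2) := by positivity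
  have hq1 : ((k : ℝ) + 1) / (k + 2) < 1 := (div_lt_one (by positivity)).2 (by linarith)
  have hlim (C : ℝ) : Tendsto (fun ν : ℝ => (((k : ℝ) + 1) / (k + 2)) ^ ν * C) atTop (𝓝 0) := by
    simpa using (tendsto_rpow_atTop_of_base_lt_one _ (by linarith) hq1).mul_const C
  have hΔ : 0 < μ - k := sub_pos.2 hk
  filter_upwards [eventually_ge_atTop 1,
    (hlim (∑' y : ℕ, (y : ℝ) * (μ - k) ^ (y - k))).eventually_lt_const (pow_pos hΔ 2),
    (hlim (k * μ)).eventually_lt_const (by linarith : 0 < 1 - (μ - k))] with ν hν hlow hupp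
  obtain ⟨hl, hmean⟩ := hlam ν (by linarith)
  have hm : (0 : ℝ) < ((k + 1 : ℕ) : ℝ) ^ ν := by positivity
  set r := lam ν / ((k + 1 : ℕ) : ℝ) ^ ν with hr_def
  have hr : 0 < r := by positivity
  have hlr : lam ν = r * ((k + 1 : ℕ) : ℝ) ^ ν := (div_mul_cancel₀ _ hm.ne').symm
  have hs := summable_meanConstraint_terms μ hl hν
  unfold meanConstraint at hmean
  simp only [hlr, mul_div_assoc, cmp_weight_eq] at hs hmean
  have hA : (0 : ℝ) < (((k + 1 : ℕ) : ℝ) ^ k / k.factorial) ^ ν := by positivity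
  have hmk : ((k + 1 : ℕ) : ℝ) ^ (k + 1) / (k + 1).factorial
      = ((k + 1 : ℕ) : ℝ) ^ k / k.factorial := by
    rw [Nat.factorial_succ, pow_succ]; push_cast; field_simp
  have hwq (y : ℕ) (h₁ : y ≠ k) (h₂ : y ≠ k + 1) :
      r ^ y * (((k + 1 : ℕ) : ℝ) ^ y / y.factorial) ^ ν
        ≤ r ^ y * ((((k : ℝ) + 1) / (k + 2)) ^ ν
          * (((k + 1 : ℕ) : ℝ) ^ k / k.factorial) ^ ν) := by
    rw [← Real.mul_rpow hq0.le (by positivity)]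
    gcongr
    exact pow_div_factorial_le_mul h₁ h₂
  rw [hlr, mul_lt_mul_iff_left₀ hm, mul_lt_mul_iff_left₀ hm]
  constructor
  · by_contra! h
    exact (tsum_sub_mul_neg hk hk1 hr hA (fun y => by positivity) rfl (by rw [hmk]) hwq
      (by positivity) hs h hlow).ne hmean
  · by_contra! h
    exact (tsum_sub_mul_pos hk hk1 hA (fun y => by positivity) rfl (by rw [hmk]) hwq
      (by positivity) hs h hupp).ne' hmean
end

section
/- Fix an integer μ ≥ 1 and define m_ν(λ) = Σ_{y=0}^∞ (y − μ) λ^y/(y!)^ν. Then for any fixed a > 0, m_ν(a·μ^ν) < 0 for all sufficiently large ν. -/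
open Filter Real Topology

/-- `m_ν(λ) = ∑_{y=0}^∞ (y − μ) λ^y / (y!)^ν`. -/
noncomputable def mFun (μ l ν : ℝ) : ℝ :=
  ∑' y : ℕ, ((y : ℝ) - μ) * l ^ y / (y.factorial : ℝ) ^ ν

/-- Below its mode, `y ↦ (n + 1) ^ y / y!` is strictly increasing. -/
theorem succ_pow_mul_factorial_lt_of_lt {n y : ℕ} (h : y < n) :
    (n + 1) ^ y * n.factorial < (n + 1) ^ n * y.factorial := by
  suffices H : ∀ m, y + 1 ≤ m → m ≤ n →
      (n + 1) ^ y * m.factorial < (n + 1) ^ m * y.factorial from H n h le_rfl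
  intro m hm
  induction m, hm using Nat.le_induction with
  | base =>
    intro hy
    have : 0 < (n + 1) ^ y * y.factorial := by positivity
    rw [Nat.factorial_succ, pow_succ]
    nlinarith
  | succ m hm ih =>
    intro hmn
    have := ih (by omega)
    have : 0 < (n + 1) ^ y * m.factorial := by positivity
    rw [Nat.factorial_succ, pow_succ]
    nlinarith

/-- Above its mode, `y ↦ (n + 1) ^ y / y!` is strictly decreasing. -/
theorem succ_pow_mul_factorial_lt_of_gt {n y : ℕ} (h : n + 2 ≤ y) :
    (n + 1) ^ y * n.factorial < (n + 1) ^ n * y.factorial := by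
  induction y, h using Nat.le_induction with
  | base =>
    have : 0 < (n + 1) ^ n * n.factorial * (n + 1) := by positivity
    rw [Nat.factorial_succ, Nat.factorial_succ, pow_succ, pow_succ]
    nlinarith
  | succ y hy ih =>
    have : 0 < (n + 1) ^ y * n.factorial := by positivity
    rw [Nat.factorial_succ, pow_succ]
    nlinarith

/-- The ratio of `(n + 1) ^ y / y!` to its maximal value `(n + 1) ^ n / n!`. -/
noncomputable def modeRatio (n y : ℕ) : ℝ :=
  ((n + 1 : ℕ) : ℝ) ^ y / y.factorial / (((n + 1 : ℕ) : ℝ) ^ n / n.factorial)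

theorem modeRatio_pos (n y : ℕ) : 0 < modeRatio n y := by
  unfold modeRatio; positivity

theorem modeRatio_self (n : ℕ) : modeRatio n n = 1 := by
  unfold modeRatio
  exact div_self (by positivity)

theorem modeRatio_lt_one {n y : ℕ} (h : y ≠ n) (h' : y ≠ n + 1) : modeRatio n y < 1 := by
  have key : (n + 1) ^ y * n.factorial < (n + 1) ^ n * y.factorial := by
    rcases lt_or_gt_of_ne h with h | h
    · exact succ_pow_mul_factorial_lt_of_lt h
    · exact succ_pow_mul_factorial_lt_of_gt (by omega)
  unfold modeRatio
  rw [div_lt_one (by positivity), div_lt_div_iff₀ (by positivity) (by positivity)]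
  exact_mod_cast key

theorem summable_abs_sub_mul_modeRatio (n : ℕ) {a : ℝ} (ha : 0 < a) :
    Summable fun y : ℕ => |(y : ℝ) - (n + 1 : ℕ)| * a ^ y * modeRatio n y := by
  set μ : ℝ := ((n + 1 : ℕ) : ℝ) with hμ
  have hμ0 : 0 < μ := by positivity
  refine Summable.of_nonneg_of_le (fun y => ?_) (fun y => ?_)
    ((Real.summable_pow_div_factorial (2 * a * μ)).mul_left ((1 + μ) / (μ ^ n / n.factorial)))
  · have := modeRatio_pos n y
    positivity
  · have h2 : (y : ℝ) ≤ 2 ^ y := by exact_mod_cast Nat.lt_two_pow_self.le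
    have h1 : (1 : ℝ) ≤ 2 ^ y := one_le_pow₀ (by norm_num)
    have hb : |(y : ℝ) - μ| ≤ (1 + μ) * 2 ^ y := by
      have : (0 : ℝ) ≤ y := y.cast_nonneg
      rw [abs_le]
      constructor <;> nlinarith
    calc |(y : ℝ) - μ| * a ^ y * modeRatio n y
        ≤ (1 + μ) * 2 ^ y * a ^ y * modeRatio n y := by
          have := modeRatio_pos n y
          gcongr
      _ = (1 + μ) / (μ ^ n / n.factorial) * ((2 * a * μ) ^ y / y.factorial) := by
          unfold modeRatio
          rw [mul_pow, mul_pow]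
          ring

theorem tendsto_tsum_mul_modeRatio_rpow (n : ℕ) {a : ℝ} (ha : 0 < a) :
    Tendsto (fun ν : ℝ => ∑' y : ℕ, ((y : ℝ) - (n + 1 : ℕ)) * a ^ y * modeRatio n y ^ ν)
      atTop (𝓝 (-a ^ n)) := by
  have hlim : ∑' y : ℕ, (if y = n then -a ^ n else 0) = -a ^ n := tsum_ite_eq n _
  rw [← hlim]
  refine tendsto_tsum_of_dominated_convergence (summable_abs_sub_mul_modeRatio n ha)
    (fun y => ?_) ?_
  · by_cases h : y = n
    · subst h
      simp [modeRatio_self]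
    by_cases h' : y = n + 1
    · subst h'
      simp
    · rw [if_neg h]
      simpa using (tendsto_rpow_atTop_of_base_lt_one _ (by linarith [modeRatio_pos n y])
        (modeRatio_lt_one h h')).const_mul (((y : ℝ) - (n + 1 : ℕ)) * a ^ y)
  · filter_upwards [eventually_ge_atTop 1] with ν hν y
    have hr := modeRatio_pos n y
    rw [norm_mul, norm_mul, Real.norm_eq_abs, Real.norm_of_nonneg (by positivity : 0 ≤ a ^ y),
      Real.norm_of_nonneg (by positivity : 0 ≤ modeRatio n y ^ ν)]
    by_cases h' : y = n + 1
    · subst h'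
      simp
    have hle : modeRatio n y ≤ 1 := by
      by_cases h : y = n
      · subst h
        exact (modeRatio_self y).le
      · exact (modeRatio_lt_one h h').le
    gcongr
    simpa using Real.rpow_le_rpow_of_exponent_ge hr hle hν

theorem mFun_eq_rpow_mul_tsum (n : ℕ) (a ν : ℝ) :
    mFun ((n + 1 : ℕ) : ℝ) (a * ((n + 1 : ℕ) : ℝ) ^ ν) ν =
      (((n + 1 : ℕ) : ℝ) ^ n / n.factorial) ^ ν *
        ∑' y : ℕ, ((y : ℝ) - (n + 1 : ℕ)) * a ^ y * modeRatio n y ^ ν := by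
  rw [mFun, ← tsum_mul_left]
  congr 1 with y
  have hM : (0 : ℝ) < (((n + 1 : ℕ) : ℝ) ^ n / n.factorial) ^ ν := by positivity
  unfold modeRatio
  rw [Real.div_rpow (x := ((n + 1 : ℕ) : ℝ) ^ y / y.factorial) (by positivity) (by positivity),
    Real.div_rpow (x := ((n + 1 : ℕ) : ℝ) ^ y) (by positivity) (by positivity), mul_pow,
    Real.rpow_pow_comm (by positivity)]
  field_simp

/-- For integer `μ ≥ 1` and any fixed `a > 0`, `m_ν(a μ^ν) < 0` for all
sufficiently large `ν`. -/
theorem stmt11 (μ : ℕ) (hμ : 1 ≤ μ) (a : ℝ) (ha : 0 < a) :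
    ∀ᶠ ν in (atTop : Filter ℝ), mFun (μ : ℝ) (a * (μ : ℝ) ^ ν) ν < 0 := by
  obtain ⟨n, rfl⟩ := Nat.exists_eq_add_of_le' hμ
  have hneg : -a ^ n < 0 := neg_neg_of_pos (pow_pos ha n)
  filter_upwards [(tendsto_tsum_mul_modeRatio_rpow n ha).eventually_lt_const hneg] with ν hν
  rw [mFun_eq_rpow_mul_tsum]
  exact mul_neg_of_pos_of_neg (by positivity) hν
end

section
/- Fix an integer μ ≥ 1 and define m_ν(λ) = Σ_{y=0}^∞ (y − μ) λ^y/(y!)^ν. Then for any fixed b > 0, m_ν(b·(μ+1)^ν) > 0 for all sufficiently large ν. -/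
open Filter Real Topology

lemma summable_pow_div_factorial_rpow {c ν : ℝ} (hc : 0 < c) (hν : 0 < ν) :
    Summable fun y : ℕ => c ^ y / (y.factorial : ℝ) ^ ν := by
  have hpos : ∀ y : ℕ, 0 < c ^ y / (y.factorial : ℝ) ^ ν := fun y => by positivity
  refine summable_of_ratio_test_tendsto_lt_one (l := 0) one_pos
    (Eventually.of_forall fun y => (hpos y).ne') ?_
  have hratio : ∀ y : ℕ, ‖c ^ (y + 1) / ((y + 1).factorial : ℝ) ^ ν‖ /
      ‖c ^ y / (y.factorial : ℝ) ^ ν‖ = c / ((y + 1 : ℕ) : ℝ) ^ ν := fun y => by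
    rw [norm_of_nonneg (hpos _).le, norm_of_nonneg (hpos _).le, Nat.factorial_succ, Nat.cast_mul,
      mul_rpow (by positivity) (by positivity), pow_succ]
    have : (0 : ℝ) < ((y + 1 : ℕ) : ℝ) ^ ν := by positivity
    field_simp
  simp only [hratio]
  exact ((tendsto_rpow_atTop hν).comp
    (tendsto_natCast_atTop_atTop.comp (tendsto_add_atTop_nat 1))).const_div_atTop c

lemma summable_sub_mul_pow_div_factorial_rpow (μ : ℕ) {l ν : ℝ} (hl : 0 < l) (hν : 0 < ν) :
    Summable fun y : ℕ => ((y : ℝ) - μ) * l ^ y / (y.factorial : ℝ) ^ ν := by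
  refine Summable.of_norm_bounded (((summable_pow_div_factorial_rpow
    (mul_pos two_pos hl) hν)).mul_left ((μ : ℝ) + 1)) fun y => ?_
  have hy : (y : ℝ) ≤ 2 ^ y := by exact_mod_cast Nat.lt_two_pow_self.le
  have h1 : (1 : ℝ) ≤ 2 ^ y := one_le_pow₀ one_le_two
  have hμ : (0 : ℝ) ≤ μ := μ.cast_nonneg
  have habs : |(y : ℝ) - μ| ≤ (μ + 1) * 2 ^ y := by
    rw [abs_le]
    constructor <;> nlinarith [y.cast_nonneg (α := ℝ), mul_nonneg hμ (sub_nonneg.2 h1)]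
  rw [norm_eq_abs, abs_div, abs_mul, abs_of_pos (pow_pos hl y),
    abs_of_pos (show (0 : ℝ) < (y.factorial : ℝ) ^ ν by positivity), mul_pow, ← mul_div_assoc,
    ← mul_assoc]
  gcongr

lemma pow_div_factorial_lt_of_lt {n y : ℕ} (hy : y < n) :
    ((n : ℝ) + 1) ^ y / y.factorial < ((n : ℝ) + 1) ^ n / n.factorial := by
  have h : n.factorial < y.factorial * (n + 1) ^ (n - y) :=
    calc n.factorial = (y + (n - y)).factorial := by rw [Nat.add_sub_cancel' hy.le]
      _ ≤ y.factorial * (y + (n - y)) ^ (n - y) := by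
        rw [← Nat.factorial_mul_ascFactorial]
        exact Nat.mul_le_mul_left _ (Nat.ascFactorial_le_pow_add y (n - y))
      _ < y.factorial * (n + 1) ^ (n - y) := by
        rw [Nat.add_sub_cancel' hy.le]
        exact Nat.mul_lt_mul_of_pos_left
          (Nat.pow_lt_pow_left n.lt_succ_self (Nat.sub_pos_of_lt hy).ne') y.factorial_pos
  have h' : (n.factorial : ℝ) < y.factorial * ((n : ℝ) + 1) ^ (n - y) := by exact_mod_cast h
  rw [div_lt_div_iff₀ (by positivity) (by positivity)]
  calc ((n : ℝ) + 1) ^ y * n.factorial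
      < ((n : ℝ) + 1) ^ y * (y.factorial * ((n : ℝ) + 1) ^ (n - y)) := by gcongr
    _ = ((n : ℝ) + 1) ^ n * y.factorial := by
      rw [mul_left_comm, ← pow_add, Nat.add_sub_cancel' hy.le, mul_comm]

/-- For integer `μ ≥ 1` and any fixed `b > 0`, `m_ν(b (μ+1)^ν) > 0` for all
sufficiently large `ν`. -/
theorem stmt12 (μ : ℕ) (hμ : 1 ≤ μ) (b : ℝ) (hb : 0 < b) :
    ∀ᶠ ν in (atTop : Filter ℝ), 0 < mFun (μ : ℝ) (b * ((μ : ℝ) + 1) ^ ν) ν := by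
  set a : ℕ → ℝ := fun y => ((μ : ℝ) + 1) ^ y / y.factorial with ha
  have ha_pos : ∀ y, 0 < a y := fun y => by positivity
  have ha_succ : a (μ + 1) = a μ := by
    simp only [ha, Nat.factorial_succ, pow_succ]
    push_cast
    field_simp
  have hterm : ∀ (ν : ℝ) (y : ℕ), ((y : ℝ) - μ) * (b * ((μ : ℝ) + 1) ^ ν) ^ y /
      (y.factorial : ℝ) ^ ν = ((y : ℝ) - μ) * b ^ y * a y ^ ν := fun ν y => by
    rw [div_rpow (by positivity) (by positivity), ← rpow_natCast_mul (by positivity),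
      mul_comm (y : ℝ) ν, rpow_mul_natCast (by positivity), mul_pow]
    ring
  have hlim : Tendsto (fun ν : ℝ => ∑ y ∈ Finset.range μ,
      ((y : ℝ) - μ) * b ^ y * (a y / a μ) ^ ν) atTop (𝓝 0) := by
    rw [← Finset.sum_const_zero (s := Finset.range μ)]
    refine tendsto_finsetSum _ fun y hy => ?_
    have hlt : a y / a μ < 1 :=
      (div_lt_one (ha_pos μ)).2 (pow_div_factorial_lt_of_lt (Finset.mem_range.1 hy))
    have hgt : -1 < a y / a μ := by linarith [div_pos (ha_pos y) (ha_pos μ)]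
    simpa using (tendsto_rpow_atTop_of_base_lt_one _ hgt hlt).const_mul (((y : ℝ) - μ) * b ^ y)
  filter_upwards [hlim.eventually_const_lt (neg_neg_of_pos (pow_pos hb (μ + 1))),
    eventually_gt_atTop 0] with ν hν hν0
  have hsum := summable_sub_mul_pow_div_factorial_rpow μ
    (l := b * ((μ : ℝ) + 1) ^ ν) (by positivity) hν0
  refine lt_of_lt_of_le ?_ (hsum.sum_le_tsum (Finset.range (μ + 2)) fun y hy => ?_)
  · simp only [hterm]
    have hfac : ∑ y ∈ Finset.range μ, ((y : ℝ) - μ) * b ^ y * a y ^ ν =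
        (∑ y ∈ Finset.range μ, ((y : ℝ) - μ) * b ^ y * (a y / a μ) ^ ν) * a μ ^ ν := by
      rw [Finset.sum_mul]
      refine Finset.sum_congr rfl fun y _ => ?_
      rw [div_rpow (ha_pos y).le (ha_pos μ).le, mul_assoc _ (_ / _),
        div_mul_cancel₀ _ (rpow_pos_of_pos (ha_pos μ) ν).ne']
    rw [Finset.sum_range_succ, Finset.sum_range_succ, hfac, ha_succ]
    push_cast
    nlinarith [rpow_pos_of_pos (ha_pos μ) ν]
  · have hy' : (μ : ℝ) ≤ y := by
      rw [Finset.mem_range, not_lt] at hy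
      exact_mod_cast (Nat.le_add_right μ 2).trans hy
    have := sub_nonneg.2 hy'
    positivity
end

section
/- Fix a non-integer real μ > 0, set Δ = μ − ⌊μ⌋ ∈ (0,1), and define m_ν(λ) = Σ_{y=0}^∞ (y − μ) λ^y/(y!)^ν. Then m_ν(Δ·⌈μ⌉^ν) < 0 for all sufficiently large ν. -/
open Filter Real Topology

theorem pow_div_factorial_le_geometric (N k : ℕ) :
    (N : ℝ) ^ (N + k) / ((N + k).factorial : ℝ) ≤
      (N : ℝ) ^ N / (N.factorial : ℝ) * ((N : ℝ) / (N + 1)) ^ k := by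
  have h : (N.factorial : ℝ) * ((N : ℝ) + 1) ^ k ≤ ((N + k).factorial : ℝ) := by
    exact_mod_cast Nat.factorial_mul_pow_le_factorial (m := N) (n := k)
  have hN : (0 : ℝ) < N.factorial := by positivity
  rw [div_pow, div_mul_div_comm, ← pow_add]
  gcongr

theorem mul_rpow_pow_div_rpow {d a b : ℝ} (ha : 0 ≤ a) (hb : 0 ≤ b) (ν : ℝ) (y : ℕ) :
    (d * a ^ ν) ^ y / b ^ ν = d ^ y * (a ^ y / b) ^ ν := by
  rw [mul_pow, Real.div_rpow (by positivity) hb, ← Real.rpow_mul_natCast ha,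
    ← Real.rpow_natCast_mul ha, mul_comm ν, mul_div_assoc]

/-- For `μ = n + d`, the series is dominated by its terms at `n` and `n + 1` together with a
geometric remainder of ratio `((n + 1) / (n + 2)) ^ ν`. -/
theorem mFun_neg_of_geometric_lt {n : ℕ} {d ν r : ℝ} (hd0 : 0 < d) (hd1 : d < 1) (hν : 0 ≤ ν)
    (hr : r = (((n + 1 : ℕ) : ℝ) / ((n + 1 : ℕ) + 1)) ^ ν) (hr1 : r < 1)
    (hS : r / (1 - r) ^ 2 + (1 - d) * (1 - r)⁻¹ < 1) :
    mFun (n + d) (d * ((n + 1 : ℕ) : ℝ) ^ ν) ν < 0 := by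
  have hr0 : 0 ≤ r := by rw [hr]; positivity
  set N : ℕ := n + 1 with hN
  set C : ℝ := ((N : ℝ) ^ N / (N.factorial : ℝ)) ^ ν with hC
  have hC0 : 0 < C := by positivity
  set f : ℕ → ℝ := fun y ↦
    ((y : ℝ) - (n + d)) * (d * (N : ℝ) ^ ν) ^ y / (y.factorial : ℝ) ^ ν with hf
  have hfy (y : ℕ) : f y = ((y : ℝ) - (n + d)) * (d ^ y * ((N : ℝ) ^ y / y.factorial) ^ ν) := by
    rw [hf, ← mul_rpow_pow_div_rpow (by positivity) (by positivity), ← mul_div_assoc]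
  have hnonneg (k : ℕ) : 0 ≤ f (k + N) := by
    rw [hfy]
    refine mul_nonneg ?_ (by positivity)
    rw [hN]; push_cast
    linarith [(k.cast_nonneg : (0 : ℝ) ≤ k)]
  have hle (k : ℕ) : f (k + N) ≤ d ^ N * C * (k * r ^ k + (1 - d) * r ^ k) := by
    have hk : (((k + N : ℕ) : ℝ) - (n + d)) = k + (1 - d) := by rw [hN]; push_cast; ring
    have hk0 : (0 : ℝ) ≤ k + (1 - d) := by linarith [(k.cast_nonneg : (0 : ℝ) ≤ k)]
    have hpow : ((N : ℝ) ^ (k + N) / ((k + N).factorial : ℝ)) ^ ν ≤ C * r ^ k := by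
      calc _ ≤ ((N : ℝ) ^ N / (N.factorial : ℝ) * ((N : ℝ) / (N + 1)) ^ k) ^ ν := by
            rw [add_comm k N]
            exact Real.rpow_le_rpow (by positivity) (pow_div_factorial_le_geometric N k) hν
        _ = C * r ^ k := by
            rw [Real.mul_rpow (by positivity) (by positivity), hr,
              ← Real.rpow_mul_natCast (by positivity), ← Real.rpow_natCast_mul (by positivity),
              mul_comm ν]
    have hdk : d ^ (k + N) ≤ d ^ N := pow_le_pow_of_le_one hd0.le hd1.le (by omega)
    rw [hfy, hk]
    calc _ ≤ (k + (1 - d)) * (d ^ N * (C * r ^ k)) := by gcongr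
      _ = _ := by ring
  have hnorm : ‖r‖ < 1 := by rwa [Real.norm_of_nonneg hr0]
  have hsum : HasSum (fun k : ℕ ↦ d ^ N * C * (k * r ^ k + (1 - d) * r ^ k))
      (d ^ N * C * (r / (1 - r) ^ 2 + (1 - d) * (1 - r)⁻¹)) :=
    ((hasSum_coe_mul_geometric_of_norm_lt_one hnorm).add
      ((hasSum_geometric_of_norm_lt_one hnorm).mul_left _)).mul_left _
  have hsf : Summable fun k ↦ f (k + N) := hsum.summable.of_nonneg_of_le hnonneg hle
  have htail : ∑' k, f (k + N) < d ^ N * C := by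
    calc _ ≤ _ := hsf.tsum_le_of_sum_le fun s ↦
            (Finset.sum_le_sum fun k _ ↦ hle k).trans
              (sum_le_hasSum s (fun k _ ↦ (hnonneg k).trans (hle k)) hsum)
      _ < d ^ N * C * 1 := by gcongr
      _ = _ := mul_one _
  have hhead : ∑ y ∈ Finset.range n, f y ≤ 0 := by
    refine Finset.sum_nonpos fun y hy ↦ ?_
    have hyn : (y : ℝ) ≤ n := by exact_mod_cast (Finset.mem_range.mp hy).le
    rw [hfy]
    exact mul_nonpos_of_nonpos_of_nonneg (by linarith) (by positivity)
  have hfn : f n = -(d ^ N * C) := by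
    have hCn : (N : ℝ) ^ n / (n.factorial : ℝ) = (N : ℝ) ^ N / (N.factorial : ℝ) := by
      have hN0 : ((n : ℝ) + 1) ≠ 0 := by positivity
      have hn0 : (n.factorial : ℝ) ≠ 0 := by positivity
      rw [hN, Nat.factorial_succ]; push_cast
      field_simp
      ring
    rw [hfy, hCn, ← hC, hN, pow_succ]
    ring
  change ∑' y, f y < 0
  rw [← ((summable_nat_add_iff N).mp hsf).sum_add_tsum_nat_add N, hN, Finset.sum_range_succ, hfn]
  linarith

/-- For non-integer `μ > 0` with `Δ = μ − ⌊μ⌋`, `m_ν(Δ⌈μ⌉^ν) < 0` for all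
sufficiently large `ν`. -/
theorem stmt13 (μ : ℝ) (hμ : 0 < μ) (hni : ¬ ∃ n : ℤ, (n : ℝ) = μ) :
    ∀ᶠ ν in (atTop : Filter ℝ),
      mFun μ ((μ - ⌊μ⌋₊) * (⌈μ⌉₊ : ℝ) ^ ν) ν < 0 := by
  set n := ⌊μ⌋₊ with hn
  set d := μ - n with hd
  have hμd : μ = n + d := by rw [hd]; ring
  have hnμ : (n : ℝ) ≤ μ := Nat.floor_le hμ.le
  have hd0 : 0 < d := sub_pos.mpr (hnμ.lt_of_ne fun h ↦ hni ⟨n, by exact_mod_cast h⟩)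
  have hd1 : d < 1 := by linarith [Nat.lt_floor_add_one μ]
  have hceil : ⌈μ⌉₊ = n + 1 := by
    rw [Nat.ceil_eq_iff (by omega)]
    constructor <;> simp <;> linarith
  have hr : Tendsto (fun ν : ℝ ↦ (((n + 1 : ℕ) : ℝ) / ((n + 1 : ℕ) + 1)) ^ ν) atTop (𝓝 0) := by
    refine tendsto_rpow_atTop_of_base_lt_one _ (neg_one_lt_zero.trans_le ?_) ?_
    · positivity
    · rw [div_lt_one (by positivity)]; linarith
  have hcont : ContinuousAt (fun r : ℝ ↦ r / (1 - r) ^ 2 + (1 - d) * (1 - r)⁻¹) 0 := by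
    have h₂ : ((1 : ℝ) - 0) ^ 2 ≠ 0 := by norm_num
    have h₁ : (1 : ℝ) - 0 ≠ 0 := by norm_num
    fun_prop (disch := assumption)
  have hS : ∀ᶠ r : ℝ in 𝓝 0, r / (1 - r) ^ 2 + (1 - d) * (1 - r)⁻¹ < 1 :=
    hcont.eventually_lt continuousAt_const (by simpa using hd0)
  filter_upwards [eventually_ge_atTop 0, hr.eventually hS, hr.eventually (gt_mem_nhds one_pos)]
    with ν hν hSν hrν
  have h := mFun_neg_of_geometric_lt hd0 hd1 hν rfl hrν hSν
  rwa [← hμd, ← hceil] at h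
end

section
/- For every integer μ ≥ 1, the factorial of 2μ² satisfies log((2μ²)!) > (3μ² − μ + 2)·log(μ); in particular (2μ²)! > μ^{3μ² − μ + 2} for μ ≥ 2. -/
/-- A weak form of Stirling's lower bound for the logarithm of a factorial. -/
theorem mul_log_sub_self_le_log_factorial {n : ℕ} (hn : n ≠ 0) :
    n * Real.log n - n ≤ Real.log (n.factorial : ℝ) := by
  have hstirling := Stirling.le_log_factorial_stirling hn
  have hlog : 0 ≤ Real.log n := Real.log_natCast_nonneg n
  have hpi : 0 ≤ Real.log (2 * Real.pi) :=
    Real.log_nonneg (by linarith [Real.two_le_pi])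
  linarith

/-- For every integer `μ ≥ 1`, `log((2μ²)!) > (3μ² − μ + 2) log μ`; in particular
`(2μ²)! > μ^{3μ² − μ + 2}` for `μ ≥ 2`. -/
theorem stmt16 (μ : ℕ) (hμ : 1 ≤ μ) :
    (3 * (μ : ℝ) ^ 2 - (μ : ℝ) + 2) * Real.log (μ : ℝ) <
      Real.log (((2 * μ ^ 2).factorial : ℝ)) ∧
    (2 ≤ μ → (μ : ℝ) ^ (3 * μ ^ 2 - μ + 2) < (((2 * μ ^ 2).factorial : ℝ))) := by
  have hpos : (0 : ℝ) < μ := by exact_mod_cast hμ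
  have hlog : (3 * (μ : ℝ) ^ 2 - (μ : ℝ) + 2) * Real.log (μ : ℝ) <
      Real.log (((2 * μ ^ 2).factorial : ℝ)) := by
    obtain rfl | h2 := hμ.eq_or_lt
    · simpa using Real.log_pos one_lt_two
    have h2' : (2 : ℝ) ≤ μ := by exact_mod_cast h2
    have hfac := mul_log_sub_self_le_log_factorial (n := 2 * μ ^ 2) (by positivity)
    push_cast at hfac
    rw [Real.log_mul two_ne_zero (by positivity), Real.log_pow] at hfac
    push_cast at hfac
    have hlog2 : Real.log 2 ≤ Real.log μ := Real.log_le_log two_pos h2'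
    have hlog2' := Real.log_two_gt_d9
    have hsq : 0 < (μ : ℝ) ^ 2 := by positivity
    have hgap : 0 ≤ ((μ : ℝ) - 2) * Real.log μ :=
      mul_nonneg (by linarith) (by linarith)
    have hlead : 0 < (μ : ℝ) ^ 2 * (Real.log μ + 2 * Real.log 2 - 2) :=
      mul_pos hsq (by linarith)
    linarith
  refine ⟨hlog, fun _ ↦ ?_⟩
  have hle : μ ≤ 3 * μ ^ 2 := by nlinarith
  rw [← Real.log_lt_log_iff (by positivity) (by positivity), Real.log_pow]
  push_cast [Nat.cast_sub hle]
  exact hlog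
end

section
/- Let μ ≥ 0 be real and set Δ = μ − ⌊μ⌋. For any probability distribution p on the nonnegative integers with mean Σ_{y=0}^∞ y·p(y) = μ and finite second moment, the variance satisfies Σ_{y=0}^∞ (y − μ)²·p(y) ≥ Δ(1 − Δ), with equality attained by the shifted Bernoulli distribution that places probability 1 − Δ at ⌊μ⌋ and probability Δ at ⌈μ⌉. In particular, the limiting distribution in the arbitrarily underdispersed regime is the most underdispersed discrete distribution possible for the given mean μ. -/
/-- A distribution on `ℕ` with mean `μ` has variance at least `(μ - n) * (1 - (μ - n))`
for every natural number `n`. -/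
theorem mul_one_sub_le_tsum_sq_sub_mul (n : ℕ) {μ : ℝ} {p : ℕ → ℝ} (hp0 : ∀ y, 0 ≤ p y)
    (hp : HasSum p 1) (hmean : HasSum (fun y : ℕ => (y : ℝ) * p y) μ)
    (hvar : Summable (fun y : ℕ => ((y : ℝ) - μ) ^ 2 * p y)) :
    (μ - n) * (1 - (μ - n)) ≤ ∑' y : ℕ, ((y : ℝ) - μ) ^ 2 * p y := by
  have hlin := (hmean.mul_left (2 * (n : ℝ) + 1 - 2 * μ)).add
    (hp.mul_left (μ ^ 2 - n * (n + 1)))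
  have hle := hasSum_le (fun y => ?_) hlin hvar.hasSum
  · linarith
  have hgap : 0 ≤ ((y : ℝ) - n) * ((y : ℝ) - n - 1) := by
    rcases le_or_gt y n with h | h
    · have h' : (y : ℝ) ≤ n := by exact_mod_cast h
      nlinarith
    · have h' : (n : ℝ) + 1 ≤ y := by exact_mod_cast h
      nlinarith
  linarith [mul_nonneg hgap (hp0 y)]

/-- The variance of the shifted Bernoulli distribution on `⌊μ⌋₊` and `⌈μ⌉₊` with mean `μ`. -/
theorem tsum_sq_sub_mul_shiftedBernoulli {μ : ℝ} (hμ : 0 ≤ μ) :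
    (∑' y : ℕ, ((y : ℝ) - μ) ^ 2 *
        (if y = ⌊μ⌋₊ then 1 - (μ - ⌊μ⌋₊) else if y = ⌈μ⌉₊ then μ - ⌊μ⌋₊ else 0))
      = (μ - ⌊μ⌋₊) * (1 - (μ - ⌊μ⌋₊)) := by
  rcases (Nat.floor_le hμ).eq_or_lt with h | h
  · have hzero : μ - ⌊μ⌋₊ = 0 := by linarith
    rw [tsum_eq_single ⌊μ⌋₊ (fun y hy => by simp [hy, hzero]), h]
    simp
  · have hceil : ⌈μ⌉₊ = ⌊μ⌋₊ + 1 :=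
      le_antisymm (Nat.ceil_le_floor_add_one μ) (Nat.lt_ceil.2 h)
    rw [hceil, tsum_eq_sum (s := {⌊μ⌋₊, ⌊μ⌋₊ + 1}) (fun y hy => ?_),
      Finset.sum_pair (Nat.lt_succ_self _).ne]
    · simp only [if_true, Nat.succ_ne_self, if_false]
      push_cast
      ring
    · simp only [Finset.mem_insert, Finset.mem_singleton, not_or] at hy
      simp [hy.1, hy.2]

/-- Any probability distribution on ℕ with mean `μ` and finite second moment has
variance at least `Δ(1 − Δ)` where `Δ = μ − ⌊μ⌋`, and equality is attained by the
shifted Bernoulli placing probability `1 − Δ` at `⌊μ⌋` and `Δ` at `⌈μ⌉`. -/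
theorem stmt19 (μ : ℝ) (hμ : 0 ≤ μ) (p : ℕ → ℝ)
    (hp0 : ∀ y, 0 ≤ p y) (hp1 : ∀ y, p y ≤ 1)
    (hptot : ∑' y : ℕ, p y = 1)
    (hmean_sum : Summable (fun y : ℕ => (y : ℝ) * p y))
    (hmean : ∑' y : ℕ, (y : ℝ) * p y = μ)
    (hvar_sum : Summable (fun y : ℕ => ((y : ℝ) - μ) ^ 2 * p y)) :
    (μ - ⌊μ⌋₊) * (1 - (μ - ⌊μ⌋₊)) ≤ ∑' y : ℕ, ((y : ℝ) - μ) ^ 2 * p y ∧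
    (∑' y : ℕ, ((y : ℝ) - μ) ^ 2 *
        (if y = ⌊μ⌋₊ then 1 - (μ - ⌊μ⌋₊) else if y = ⌈μ⌉₊ then μ - ⌊μ⌋₊ else 0))
      = (μ - ⌊μ⌋₊) * (1 - (μ - ⌊μ⌋₊)) := by
  have hp : Summable p := by
    by_contra h
    simp [tsum_eq_zero_of_not_summable h] at hptot
  exact ⟨mul_one_sub_le_tsum_sq_sub_mul _ hp0 (hptot ▸ hp.hasSum) (hmean ▸ hmean_sum.hasSum)
    hvar_sum, tsum_sq_sub_mul_shiftedBernoulli hμ⟩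
end
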